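/- arXiv:math/0609676 — 2 statements merged into one kernel-verified Lean document; each statement's English description precedes it below -/
import Mathlib

section
/- Let h be a faithful Haar state on A and let u ∈ M_d(A) be an irreducible unitary corepresentation. Then the d² matrix coefficients {u_{ij} : 1 ≤ i, j ≤ d} are linearly independent over ℂ; consequently the linear span of {u_{ij}} has dimension exactly d², and likewise the family {star(u_{ij}) : 1 ≤ i, j ≤ d} is linearly independent. -/
open scoped TensorProduct BigOperators ComplexOrder

/-- Apply a functional to the first tensor factor of the comultiplication: `a ↦ (φ ⊗ id)(Δ a)`. -/
noncomputable def applyFst {A : Type*} [Ring A] [Bialgebra ℂ A] (φ : A →ₗ[ℂ] ℂ) : A →ₗ[ℂ] A :=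
  (TensorProduct.lid ℂ A).toLinearMap ∘ₗ LinearMap.rTensor A φ ∘ₗ Coalgebra.comul

/-- Apply a functional to the second tensor factor of the comultiplication: `a ↦ (id ⊗ φ)(Δ a)`. -/
noncomputable def applySnd {A : Type*} [Ring A] [Bialgebra ℂ A] (φ : A →ₗ[ℂ] ℂ) : A →ₗ[ℂ] A :=
  (TensorProduct.rid ℂ A).toLinearMap ∘ₗ LinearMap.lTensor A φ ∘ₗ Coalgebra.comul

/-- `h` is a Haar state: normalized, right- and left-invariant, and positive. -/
def IsHaarState {A : Type*} [Ring A] [StarRing A] [Bialgebra ℂ A] (h : A →ₗ[ℂ] ℂ) : Prop :=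
  h 1 = 1 ∧ (∀ a : A, applySnd h a = h a • (1 : A)) ∧ (∀ a : A, applyFst h a = h a • (1 : A)) ∧
    ∀ a : A, 0 ≤ h (star a * a)

/-- The comultiplication is a `*`-homomorphism: if `Δ x = Σ aᵢ ⊗ bᵢ` then
`Δ (star x) = Σ star aᵢ ⊗ star bᵢ`. -/
def ComulStar (A : Type*) [Ring A] [StarRing A] [Bialgebra ℂ A] : Prop :=
  ∀ (x : A) (n : ℕ) (a b : Fin n → A),
    Coalgebra.comul (R := ℂ) x = ∑ i, a i ⊗ₜ[ℂ] b i →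
      Coalgebra.comul (R := ℂ) (star x) = ∑ i, star (a i) ⊗ₜ[ℂ] star (b i)

/-- `u` is a corepresentation matrix: `Δ(uᵢⱼ) = Σₖ uᵢₖ ⊗ uₖⱼ` and `ε(uᵢⱼ) = δᵢⱼ`. -/
def IsCorep {A : Type*} [Ring A] [Bialgebra ℂ A] {d : ℕ} (u : Matrix (Fin d) (Fin d) A) : Prop :=
  (∀ i j, Coalgebra.comul (R := ℂ) (u i j) = ∑ k, u i k ⊗ₜ[ℂ] u k j) ∧
    ∀ i j, Coalgebra.counit (R := ℂ) (u i j) = if i = j then 1 else 0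

/-- `u` is a unitary matrix over the `*`-algebra `A`. -/
def IsUnitaryMatrix {A : Type*} [Ring A] [StarRing A] {d : ℕ}
    (u : Matrix (Fin d) (Fin d) A) : Prop :=
  (∀ i j, ∑ k, u i k * star (u j k) = if i = j then (1 : A) else 0) ∧
    ∀ i j, ∑ k, star (u k i) * u k j = if i = j then (1 : A) else 0

/-- The scalar matrix `T` intertwines the corepresentations `u` and `v`. -/
def Intertwines {A : Type*} [Ring A] [Algebra ℂ A] {m n : ℕ}
    (u : Matrix (Fin m) (Fin m) A) (v : Matrix (Fin n) (Fin n) A)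
    (T : Matrix (Fin m) (Fin n) ℂ) : Prop :=
  ∀ i j, ∑ k, T k j • u i k = ∑ k, T i k • v k j

/-- A corepresentation is irreducible if its only self-intertwiners are scalar multiples of the
identity. -/
def IsIrreducibleCorep {A : Type*} [Ring A] [Algebra ℂ A] {d : ℕ}
    (u : Matrix (Fin d) (Fin d) A) : Prop :=
  ∀ T : Matrix (Fin d) (Fin d) ℂ, Intertwines u u T →
    ∃ c : ℂ, T = c • (1 : Matrix (Fin d) (Fin d) ℂ)

/-- Convolving the functional `h` with the product `u i k * star (u j l)`. -/
theorem applySnd_coeff_mul_star {A : Type*} [Ring A] [StarRing A] [Bialgebra ℂ A]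
    (hstar : ComulStar A) (h : A →ₗ[ℂ] ℂ) {d : ℕ} {u : Matrix (Fin d) (Fin d) A}
    (hu : IsCorep u) (i j k l : Fin d) :
    applySnd h (u i k * star (u j l)) =
      ∑ a, ∑ b, h (u a k * star (u b l)) • (u i a * star (u j b)) := by
  have hs := hstar (u j l) d (fun b => u j b) (fun b => u b l) (hu.1 j l)
  simp [applySnd, Bialgebra.comul_mul, hu.1 i k, hs, Finset.sum_mul_sum]

/-- Averaging a matrix unit over a unitary corepresentation yields a self-intertwiner. -/
theorem intertwines_haar_average {A : Type*} [Ring A] [StarRing A] [Bialgebra ℂ A]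
    (hstar : ComulStar A) {h : A →ₗ[ℂ] ℂ} (hinv : ∀ a : A, applySnd h a = h a • (1 : A))
    {d : ℕ} {u : Matrix (Fin d) (Fin d) A} (hu : IsCorep u) (huU : IsUnitaryMatrix u)
    (k l : Fin d) :
    Intertwines u u (Matrix.of fun i j => h (u i k * star (u j l))) := by
  intro i m
  simp only [Matrix.of_apply]
  have key (j : Fin d) : h (u i k * star (u j l)) • u j m =
      ∑ a, ∑ b, h (u a k * star (u b l)) • (u i a * (star (u j b) * u j m)) := by
    have := congrArg (· * u j m)
      ((hinv (u i k * star (u j l))).symm.trans (applySnd_coeff_mul_star hstar h hu i j k l))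
    simpa [Finset.sum_mul, mul_assoc] using this
  rw [Finset.sum_congr rfl fun j _ => key j, Finset.sum_comm]
  refine Finset.sum_congr rfl fun a _ => ?_
  rw [Finset.sum_comm]
  simp [← Finset.smul_sum, ← Finset.mul_sum, huU.2]

/-- Schur orthogonality: `h (u i k * star (u j l))` is `δᵢⱼ` times a matrix depending only on
`k` and `l`. -/
theorem exists_haar_mul_star_eq {A : Type*} [Ring A] [StarRing A] [Bialgebra ℂ A]
    (hstar : ComulStar A) {h : A →ₗ[ℂ] ℂ} (hinv : ∀ a : A, applySnd h a = h a • (1 : A))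
    {d : ℕ} {u : Matrix (Fin d) (Fin d) A} (hu : IsCorep u) (huU : IsUnitaryMatrix u)
    (huirr : IsIrreducibleCorep u) :
    ∃ G : Matrix (Fin d) (Fin d) ℂ,
      ∀ i j k l, h (u i k * star (u j l)) = if i = j then G k l else 0 := by
  choose G hG using fun k l => huirr _ (intertwines_haar_average hstar hinv hu huU k l)
  refine ⟨Matrix.of G, fun i j k l => ?_⟩
  simpa [Matrix.one_apply] using congrFun (congrFun (hG k l) i) j

/-- The coefficients of an irreducible unitary corepresentation are linearly independent as soon
as there is a faithful invariant functional. -/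
theorem linearIndependent_coeffs_of_faithful {A : Type*} [Ring A] [StarRing A] [Bialgebra ℂ A]
    [StarModule ℂ A] (hstar : ComulStar A) {h : A →ₗ[ℂ] ℂ}
    (hinv : ∀ a : A, applySnd h a = h a • (1 : A))
    (hfaith : ∀ a : A, h (star a * a) = 0 → a = 0)
    {d : ℕ} {u : Matrix (Fin d) (Fin d) A}
    (hu : IsCorep u) (huU : IsUnitaryMatrix u) (huirr : IsIrreducibleCorep u) :
    LinearIndependent ℂ (fun p : Fin d × Fin d => u p.1 p.2) := by
  obtain ⟨G, hG⟩ := exists_haar_mul_star_eq hstar hinv hu huU huirr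
  rw [Fintype.linearIndependent_iff]
  intro c hc
  have hcG (k l : Fin d) : ∑ j, c (k, j) * G j l = 0 := by
    have := congrArg (fun a => h (a * star (u k l))) hc
    simpa [Fintype.sum_prod_type_right, Finset.sum_mul, hG] using this
  rintro ⟨k, i⟩
  have hw : ∑ j, c (k, j) • u i j = 0 := by
    refine star_eq_zero.mp (hfaith _ ?_)
    rw [star_star]
    simp only [star_sum, star_smul, Finset.sum_mul_sum, smul_mul_smul_comm, map_sum, map_smul,
      hG, if_true, smul_eq_mul]
    rw [Finset.sum_comm]
    refine Finset.sum_eq_zero fun l _ => ?_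
    calc ∑ j, c (k, j) * star (c (k, l)) * G j l
        = star (c (k, l)) * ∑ j, c (k, j) * G j l := by
          rw [Finset.mul_sum]
          exact Finset.sum_congr rfl fun j _ => by ring
      _ = 0 := by rw [hcG, mul_zero]
  simpa [hu.2] using congrArg (Coalgebra.counit (R := ℂ)) hw

/-- Linear independence of the matrix coefficients of an irreducible unitary corepresentation,
the dimension of their span, and linear independence of their adjoints. -/
theorem coeffs_linearIndependent {A : Type*} [Ring A] [StarRing A] [HopfAlgebra ℂ A]
    [StarModule ℂ A] (hstar : ComulStar A)
    (h : A →ₗ[ℂ] ℂ) (hh : IsHaarState h) (hfaith : ∀ a : A, h (star a * a) = 0 → a = 0)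
    {d : ℕ} {u : Matrix (Fin d) (Fin d) A}
    (hu : IsCorep u) (huU : IsUnitaryMatrix u) (huirr : IsIrreducibleCorep u) :
    LinearIndependent ℂ (fun p : Fin d × Fin d => u p.1 p.2) ∧
      Module.finrank ℂ
        ↥(Submodule.span ℂ (Set.range fun p : Fin d × Fin d => u p.1 p.2)) = d ^ 2 ∧
      LinearIndependent ℂ (fun p : Fin d × Fin d => star (u p.1 p.2)) := by
  have hli := linearIndependent_coeffs_of_faithful hstar hh.2.1 hfaith hu huU huirr
  refine ⟨hli, ?_, ?_⟩
  · rw [finrank_span_eq_card hli, Fintype.card_prod, Fintype.card_fin, sq]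
  · rw [Fintype.linearIndependent_iff] at hli ⊢
    intro c hc p
    have hc' : ∑ p : Fin d × Fin d, star (c p) • u p.1 p.2 = 0 := by
      simpa [star_sum, star_smul] using congrArg star hc
    exact star_eq_zero.mp (hli _ hc' p)
end

section
/- Let h be a faithful Haar state on A, let u ∈ M_d(A) be an irreducible unitary corepresentation, and let C := span_ℂ{star(u_{ij}) : 1 ≤ i, j ≤ d} ⊆ A. For every linear functional φ : A → ℂ, the map a ↦ (φ ⊗ id)(Δ a) maps C into C, and the set of all restrictions to C of such maps (as φ ranges over all linear functionals on A) is a unital subalgebra of End_ℂ(C) that is isomorphic, as a ℂ-algebra, to the full matrix algebra M_d(ℂ). -/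
open scoped TensorProduct BigOperators ComplexOrder

/-- The linear map sending a scalar matrix `M` to `∑ i j, M i j • star (u i j)`. -/
noncomputable def starCoeffMap {A : Type*} [Ring A] [StarRing A] [Algebra ℂ A] {d : ℕ}
    (u : Matrix (Fin d) (Fin d) A) : Matrix (Fin d) (Fin d) ℂ →ₗ[ℂ] A where
  toFun M := ∑ i, ∑ j, M i j • star (u i j)
  map_add' M N := by simp [add_smul, Finset.sum_add_distrib]
  map_smul' c M := by simp [mul_smul, Finset.smul_sum]

theorem starCoeffMap_apply {A : Type*} [Ring A] [StarRing A] [Algebra ℂ A] {d : ℕ}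
    (u : Matrix (Fin d) (Fin d) A) (M : Matrix (Fin d) (Fin d) ℂ) :
    starCoeffMap u M = ∑ i, ∑ j, M i j • star (u i j) := rfl

theorem range_starCoeffMap {A : Type*} [Ring A] [StarRing A] [Algebra ℂ A] {d : ℕ}
    (u : Matrix (Fin d) (Fin d) A) :
    LinearMap.range (starCoeffMap u) =
      Submodule.span ℂ (Set.range fun p : Fin d × Fin d => star (u p.1 p.2)) := by
  apply le_antisymm
  · rintro _ ⟨M, rfl⟩
    rw [starCoeffMap_apply]
    exact Submodule.sum_mem _ fun i _ => Submodule.sum_mem _ fun j _ =>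
      Submodule.smul_mem _ _ (Submodule.subset_span ⟨(i, j), rfl⟩)
  · rw [Submodule.span_le]
    rintro _ ⟨⟨i, j⟩, rfl⟩
    refine ⟨Matrix.single i j 1, ?_⟩
    simp [starCoeffMap_apply, Matrix.single_apply, ite_and]

section Corep

variable {A : Type*} [Ring A] [StarRing A] [Bialgebra ℂ A] {d : ℕ} {u : Matrix (Fin d) (Fin d) A}

theorem IsCorep.comul_star (hu : IsCorep u) (hstar : ComulStar A) (i j : Fin d) :
    Coalgebra.comul (R := ℂ) (star (u i j)) = ∑ k, star (u i k) ⊗ₜ[ℂ] star (u k j) :=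
  hstar _ d _ _ (hu.1 i j)

theorem IsCorep.applyFst_star (hu : IsCorep u) (hstar : ComulStar A) (φ : A →ₗ[ℂ] ℂ)
    (i j : Fin d) :
    applyFst φ (star (u i j)) = ∑ k, φ (star (u i k)) • star (u k j) := by
  simp [applyFst, hu.comul_star hstar]

/-- Slicing acts on the star coefficients by left multiplication of matrices. -/
theorem IsCorep.applyFst_starCoeffMap (hu : IsCorep u) (hstar : ComulStar A) (φ : A →ₗ[ℂ] ℂ)
    (M : Matrix (Fin d) (Fin d) ℂ) :
    applyFst φ (starCoeffMap u M) =
      starCoeffMap u (Matrix.of (fun k i => φ (star (u i k))) * M) := by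
  simp only [starCoeffMap_apply, map_sum, map_smul, hu.applyFst_star hstar, Matrix.mul_apply,
    Matrix.of_apply, Finset.smul_sum, Finset.sum_smul, smul_smul]
  rw [Finset.sum_comm]
  conv_rhs => rw [Finset.sum_comm]
  refine Finset.sum_congr rfl fun j _ => ?_
  rw [Finset.sum_comm]
  simp only [mul_comm]

theorem IsCorep.applyFst_star_mul (hu : IsCorep u) (hstar : ComulStar A) (φ : A →ₗ[ℂ] ℂ)
    (k i l j : Fin d) :
    applyFst φ (star (u k i) * u l j) =
      ∑ p, ∑ q, φ (star (u k p) * u l q) • (star (u p i) * u q j) := by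
  simp [applyFst, hu.comul_star hstar, hu.1 l j, Finset.sum_mul_sum]

/-- Invariance makes `(p, q) ↦ h (star (u k p) * u l q)` a self-intertwiner. -/
theorem IsCorep.intertwines_haar (hu : IsCorep u) (huU : IsUnitaryMatrix u) (hstar : ComulStar A)
    {h : A →ₗ[ℂ] ℂ} (hh : ∀ a : A, applyFst h a = h a • (1 : A)) (k l : Fin d) :
    Intertwines u u (Matrix.of fun p q => h (star (u k p) * u l q)) := by
  intro i j
  have key (p : Fin d) : h (star (u k p) * u l j) • (1 : A) =
      ∑ r, ∑ q, h (star (u k r) * u l q) • (star (u r p) * u q j) := by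
    rw [← hh, hu.applyFst_star_mul hstar]
  calc ∑ p, h (star (u k p) * u l j) • u i p
      = ∑ p, u i p * (h (star (u k p) * u l j) • (1 : A)) := by simp
    _ = ∑ r, ∑ q, h (star (u k r) * u l q) • ((∑ p, u i p * star (u r p)) * u q j) := by
        simp only [key, Finset.mul_sum, Finset.sum_mul, Finset.smul_sum, mul_smul_comm, mul_assoc]
        rw [Finset.sum_comm]
        exact Finset.sum_congr rfl fun r _ => Finset.sum_comm
    _ = ∑ q, h (star (u k i) * u l q) • u q j := by
        rw [Finset.sum_eq_single i]
        · simp [huU.1]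
        · intro r _ hr
          simp [huU.1, hr.symm]
        · simp

/-- Orthogonality relation for the coefficients of an irreducible unitary corepresentation. -/
theorem IsCorep.exists_haar_star_mul (hu : IsCorep u) (huU : IsUnitaryMatrix u)
    (hstar : ComulStar A) (huirr : IsIrreducibleCorep u)
    {h : A →ₗ[ℂ] ℂ} (hh : ∀ a : A, applyFst h a = h a • (1 : A)) :
    ∃ c : Fin d → Fin d → ℂ, ∀ k l p q,
      h (star (u k p) * u l q) = if p = q then c k l else 0 := by
  choose c hc using fun k l => huirr _ (hu.intertwines_haar huU hstar hh k l)
  refine ⟨c, fun k l p q => ?_⟩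
  have := congrFun (congrFun (hc k l) p) q
  simpa [Matrix.one_apply] using this

/-- The coefficients of an irreducible unitary corepresentation are linearly independent. -/
theorem IsCorep.eq_zero_of_sum_smul_eq_zero [StarModule ℂ A] (hu : IsCorep u)
    (huU : IsUnitaryMatrix u) (hstar : ComulStar A) (huirr : IsIrreducibleCorep u)
    {h : A →ₗ[ℂ] ℂ} (hh : ∀ a : A, applyFst h a = h a • (1 : A))
    (hfaith : ∀ a : A, h (star a * a) = 0 → a = 0)
    {M : Matrix (Fin d) (Fin d) ℂ} (hM : ∑ i, ∑ j, M i j • u i j = 0) : M = 0 := by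
  obtain ⟨c, hc⟩ := hu.exists_haar_star_mul huU hstar huirr hh
  have gram (m j : Fin d) : ∑ k, M k j * c m k = 0 := by
    have := congrArg (fun x => h (star (u m j) * x)) hM
    simpa [Finset.mul_sum, hc] using this
  have col (i j : Fin d) : ∑ k, M k j • u k i = 0 := by
    apply hfaith
    simp only [star_sum, star_smul, Finset.sum_mul, Finset.mul_sum, smul_mul_smul_comm, map_sum,
      map_smul, hc, if_true, smul_eq_mul]
    rw [Finset.sum_comm]
    simp only [mul_assoc, ← Finset.mul_sum, gram, mul_zero, Finset.sum_const_zero]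
  ext k j
  have hone : (M k j) • (1 : A) = 0 := by
    calc (M k j) • (1 : A) = ∑ l, M l j • ∑ i, u l i * star (u k i) := by
          simp [huU.1]
      _ = ∑ i, (∑ l, M l j • u l i) * star (u k i) := by
          simp only [Finset.smul_sum, Finset.sum_mul, smul_mul_assoc]
          exact Finset.sum_comm
      _ = 0 := by simp [col]
  simpa using congrArg (Coalgebra.counit (R := ℂ)) hone

theorem IsCorep.starCoeffMap_injective [StarModule ℂ A] (hu : IsCorep u)
    (huU : IsUnitaryMatrix u) (hstar : ComulStar A) (huirr : IsIrreducibleCorep u)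
    {h : A →ₗ[ℂ] ℂ} (hh : ∀ a : A, applyFst h a = h a • (1 : A))
    (hfaith : ∀ a : A, h (star a * a) = 0 → a = 0) :
    Function.Injective (starCoeffMap u) := by
  rw [injective_iff_map_eq_zero]
  intro M hM
  have hstarM : ∑ i, ∑ j, M.map star i j • u i j = 0 := by
    simpa [starCoeffMap_apply, star_sum] using congrArg star hM
  have hzero := hu.eq_zero_of_sum_smul_eq_zero huU hstar huirr hh hfaith hstarM
  ext i j
  simpa using congrFun (congrFun hzero i) j

end Corep

/-- The span `C` of the adjoints of the coefficients of an irreducible unitary corepresentation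
is invariant under all maps `a ↦ (φ ⊗ id)(Δ a)`, and the restrictions of these maps form a
unital subalgebra of `End ℂ C` isomorphic to the full matrix algebra `M_d(ℂ)`. -/
theorem left_slice_algebra_isom_matrix {A : Type*} [Ring A] [StarRing A] [HopfAlgebra ℂ A]
    [StarModule ℂ A] (hstar : ComulStar A)
    (h : A →ₗ[ℂ] ℂ) (hh : IsHaarState h) (hfaith : ∀ a : A, h (star a * a) = 0 → a = 0)
    {d : ℕ} {u : Matrix (Fin d) (Fin d) A}
    (hu : IsCorep u) (huU : IsUnitaryMatrix u) (huirr : IsIrreducibleCorep u)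
    (C : Submodule ℂ A)
    (hC : C = Submodule.span ℂ (Set.range fun p : Fin d × Fin d => star (u p.1 p.2))) :
    (∀ (φ : A →ₗ[ℂ] ℂ) (x : A), x ∈ C → applyFst φ x ∈ C) ∧
      ∃ S : Subalgebra ℂ (Module.End ℂ ↥C),
        (S : Set (Module.End ℂ ↥C)) =
          {f : Module.End ℂ ↥C | ∃ φ : A →ₗ[ℂ] ℂ, ∀ x : ↥C, (↑(f x) : A) = applyFst φ ↑x} ∧
        Nonempty (↥S ≃ₐ[ℂ] Matrix (Fin d) (Fin d) ℂ) := by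
  rw [← range_starCoeffMap] at hC
  subst hC
  have hinj := hu.starCoeffMap_injective huU hstar huirr hh.2.2.1 hfaith
  refine ⟨?_, ?_⟩
  · rintro φ _ ⟨M, rfl⟩
    exact ⟨_, (hu.applyFst_starCoeffMap hstar φ M).symm⟩
  let e := LinearEquiv.ofInjective (starCoeffMap u) hinj
  let F : Matrix (Fin d) (Fin d) ℂ →ₐ[ℂ] Module.End ℂ (LinearMap.range (starCoeffMap u)) :=
    (LinearEquiv.conjAlgEquiv ℂ e).toAlgHom.comp (Algebra.lmul ℂ _)
  have hFapply (N M) : F N (e M) = e (N * M) := by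
    simp [F, LinearEquiv.conjAlgEquiv_apply]
  have hF : Function.Injective F :=
    (LinearEquiv.conjAlgEquiv ℂ e).injective.comp Algebra.lmul_injective
  refine ⟨F.range, ?_, ⟨(AlgEquiv.ofInjective F hF).symm⟩⟩
  ext f
  constructor
  · rintro ⟨N, rfl⟩
    obtain ⟨g, hg⟩ := LinearMap.exists_leftInverse_of_injective _ (LinearMap.ker_eq_bot.2 hinj)
    let τ : Matrix (Fin d) (Fin d) ℂ →ₗ[ℂ] ℂ :=
      ∑ i, ∑ k, N k i • Matrix.entryLinearMap ℂ ℂ i k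
    have hτ (i k : Fin d) : (τ ∘ₗ g) (star (u i k)) = N k i := by
      have hs : starCoeffMap u (Matrix.single i k 1) = star (u i k) := by
        simp [starCoeffMap_apply, Matrix.single_apply, ite_and]
      have hgs : g (star (u i k)) = Matrix.single i k 1 := by
        rw [← hs]
        exact LinearMap.congr_fun hg _
      simp [τ, hgs, Matrix.single_apply, ite_and]
    refine ⟨τ ∘ₗ g, fun x => ?_⟩
    obtain ⟨M, rfl⟩ := e.surjective x
    have hN : Matrix.of (fun k i => (τ ∘ₗ g) (star (u i k))) = N := by
      ext k i
      exact hτ i k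
    have := hu.applyFst_starCoeffMap hstar (τ ∘ₗ g) M
    rw [hN] at this
    exact (congrArg Subtype.val (hFapply N M)).trans this.symm
  · rintro ⟨φ, hφ⟩
    refine ⟨Matrix.of fun k i => φ (star (u i k)), LinearMap.ext fun x => ?_⟩
    obtain ⟨M, rfl⟩ := e.surjective x
    apply Subtype.ext
    rw [hφ]
    exact (congrArg Subtype.val (hFapply _ M)).trans (hu.applyFst_starCoeffMap hstar φ M).symm
end
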